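/- (Removing a large entry from a shared box) Let λ ⊆ ν be partitions and let T be a set-valued tableau of shape ν/λ having at least one shared box (a box whose set has at least two elements), and let y be the largest integer contained in a shared box of T. Suppose v is a finite sequence of positive integers such that the concatenation w(T)∘v is a reverse lattice word. Then there exist an integer x ≥ y and a set-valued tableau T̃ of shape ν/λ such that w(T̃)∘v is a reverse lattice word and the content of the sequence (x)∘w(T̃) equals the content of w(T). -/

import Mathlib

open MvPolynomial

/-- A set-valued tableau on an arbitrary finite set of boxes `(row, column)`.
Entries are `0`-based: the entry `i : ℕ` stands for the integer `i + 1`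
(equivalently, for the variable `x_{i+1}`).  Rows weakly increase from left to
right and columns strictly increase from top to bottom, expressed via
horizontally and vertically adjacent boxes. -/
structure SVT (cells : Finset (ℕ × ℕ)) where
  entry : ℕ × ℕ → Finset ℕ
  nonempty_of_mem : ∀ c ∈ cells, (entry c).Nonempty
  eq_empty_of_not_mem : ∀ c, c ∉ cells → entry c = ∅
  row_weak : ∀ i j, (i, j) ∈ cells → (i, j + 1) ∈ cells →
    ∀ a ∈ entry (i, j), ∀ b ∈ entry (i, j + 1), a ≤ b
  col_strict : ∀ i j, (i, j) ∈ cells → (i + 1, j) ∈ cells →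
    ∀ a ∈ entry (i, j), ∀ b ∈ entry (i + 1, j), a < b

namespace SVT

variable {cells : Finset (ℕ × ℕ)}

/-- `|T|`: the total number of integers in the boxes of `T`. -/
def size (T : SVT cells) : ℕ := ∑ c ∈ cells, (T.entry c).card

/-- `T` has all its entries among `{1, …, m}` (i.e. `0`-based entries `< m`). -/
def Bounded (T : SVT cells) (m : ℕ) : Prop := ∀ c, ∀ x ∈ T.entry c, x < m

/-- The monomial `x^T`, where the exponent of the variable `i` is the number of
boxes of `T` containing `i`. -/
noncomputable def monomial (T : SVT cells) : MvPolynomial ℕ ℤ :=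
  ∏ c ∈ cells, ∏ i ∈ T.entry c, X i

/-- The column word of `T`: columns are read from left to right, each column
from bottom to top, the integers within a box in increasing order. -/
def word (T : SVT cells) : List ℕ :=
  (List.range ((cells.sup fun c => max c.1 c.2) + 1)).flatMap fun j =>
    ((List.range ((cells.sup fun c => max c.1 c.2) + 1)).reverse).flatMap fun i =>
      (T.entry (i, j)).sort (· ≤ ·)

end SVT

/-- The stable Grothendieck polynomial of the shape given by `cells`, in the
variables `x_1, …, x_m` (`0`-based: variables `0, …, m-1`):
`G(cells) = ∑_T (-1)^(|T| - #cells) x^T` over set-valued tableaux `T` of shape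
`cells` with entries in `{1, …, m}`. -/
noncomputable def grothendieck (cells : Finset (ℕ × ℕ)) (m : ℕ) : MvPolynomial ℕ ℤ :=
  ∑ᶠ (T : SVT cells) (_ : T.Bounded m), ((-1 : ℤ) ^ (T.size - cells.card)) • T.monomial

/-- A reverse lattice word: every suffix contains, for each `i`, at least as
many occurrences of `i` as of `i + 1`. -/
def IsRLW (w : List ℕ) : Prop := ∀ s, s <:+ w → ∀ i, s.count (i + 1) ≤ s.count i

/-- A partial reverse lattice word with respect to the (`0`-based, half-open)
interval `[a, b)`:  every suffix contains, for each `t` with `a ≤ t` and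
`t + 1 < b`, at least as many occurrences of `t` as of `t + 1`. -/
def IsPartialRLW (a b : ℕ) (w : List ℕ) : Prop :=
  ∀ s, s <:+ w → ∀ t, a ≤ t → t + 1 < b → s.count (t + 1) ≤ s.count t

/-- `w` has content `ν`: the number of occurrences of `i` in `w` is the length
of the `i`-th row of `ν`. -/
def HasContent (w : List ℕ) (nu : YoungDiagram) : Prop := ∀ i, w.count i = nu.rowLen i

/-- The cells of the skew diagram `λ * μ`, obtained by placing `λ` and `μ`
corner to corner: `λ` occupies rows `0, …, ℓ(λ)-1` shifted right by `μ₁`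
columns, and `μ` occupies the rows below row `ℓ(λ)-1`. -/
def starCells (lam mu : YoungDiagram) : Finset (ℕ × ℕ) :=
  (lam.cells.image fun c => (c.1, c.2 + mu.rowLen 0)) ∪
    (mu.cells.image fun c => (c.1 + lam.colLen 0, c.2))

/-- The structure constant `c^ν_{λμ}`: `(-1)^(|ν|-|λ|-|μ|)` times the number of
set-valued tableaux of shape `λ * μ` whose word is a reverse lattice word with
content `ν`. -/
noncomputable def cLR (lam mu nu : YoungDiagram) : ℤ :=
  (-1 : ℤ) ^ (nu.card - lam.card - mu.card) *
    (Nat.card {T : SVT (starCells lam mu) // IsRLW T.word ∧ HasContent T.word nu} : ℤ)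

/-- The coproduct structure constant `d^ν_{λμ}`: `(-1)^(|λ|+|μ|-|ν|)` times the
number of set-valued tableaux of shape `ν` whose word is a partial reverse
lattice word with respect to both intervals `[1, ℓ(λ)]` and
`[ℓ(λ)+1, ℓ(λ)+ℓ(μ)]` and has content `(λ₁, …, λ_{ℓ(λ)}, μ₁, …, μ_{ℓ(μ)})`. -/
noncomputable def dCoeff (lam mu nu : YoungDiagram) : ℤ :=
  (-1 : ℤ) ^ (lam.card + mu.card - nu.card) *
    (Nat.card {T : SVT nu.cells //
      IsPartialRLW 0 (lam.colLen 0) T.word ∧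
      IsPartialRLW (lam.colLen 0) (lam.colLen 0 + mu.colLen 0) T.word ∧
      ∀ i, T.word.count i =
        if i < lam.colLen 0 then lam.rowLen i else mu.rowLen (i - lam.colLen 0)} : ℤ)

/-- The coefficient `α_{θ,μ}` for a shape `θ` given by `cells`:
`(-1)^(|μ|-|θ|)` times the number of set-valued tableaux of shape `θ` whose
word is a reverse lattice word with content `μ`. -/
noncomputable def alphaCoeff (cells : Finset (ℕ × ℕ)) (mu : YoungDiagram) : ℤ :=
  (-1 : ℤ) ^ (mu.card - cells.card) *
    (Nat.card {T : SVT cells // IsRLW T.word ∧ HasContent T.word mu} : ℤ)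

/-- `ν/λ` is a vertical strip: at most one box in each row. -/
def IsVerticalStrip (lam nu : YoungDiagram) : Prop := ∀ i, nu.rowLen i ≤ lam.rowLen i + 1

/-- `ν/λ` is a horizontal strip: at most one box in each column. -/
def IsHorizontalStrip (lam nu : YoungDiagram) : Prop := ∀ j, nu.colLen j ≤ lam.colLen j + 1

/-- A set of boxes is a rook strip if it has at most one box in each row and in
each column. -/
def IsRookStripCells (s : Finset (ℕ × ℕ)) : Prop :=
  (∀ i, (s.filter fun c => c.1 = i).card ≤ 1) ∧ (∀ j, (s.filter fun c => c.2 = j).card ≤ 1)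

/-- The rectangular Young diagram with `p` rows and `q` columns. -/
def rect (p q : ℕ) : YoungDiagram :=
  ⟨Finset.range p ×ˢ Finset.range q, by
    intro a b hba ha
    simp only [Finset.coe_product, Set.mem_prod, Finset.mem_coe, Finset.mem_range] at ha ⊢
    exact ⟨lt_of_le_of_lt hba.1 ha.1, lt_of_le_of_lt hba.2 ha.2⟩⟩

/-- The position of a box in the reversed column word: columns from right to left, each column
from top to bottom. -/
def readingPos (c : ℕ × ℕ) : ℤ ×ₗ ℤ := toLex (-(c.2 : ℤ), (c.1 : ℤ))

lemma readingPos_lt {i j i' j' : ℕ} :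
    readingPos (i, j) < readingPos (i', j') ↔ j' < j ∨ j = j' ∧ i < i' := by
  simp only [readingPos, Prod.Lex.toLex_lt_toLex]
  omega

lemma readingPos_injective : Function.Injective readingPos := by
  rintro ⟨i, j⟩ ⟨i', j'⟩ h
  simp only [readingPos, EmbeddingLike.apply_eq_iff_eq, Prod.mk.injEq] at h
  ext <;> simp <;> omega

/-- The number of boxes of `cells` satisfying `P` whose set contains `k`. -/
noncomputable def boxCount (cells : Finset (ℕ × ℕ)) (F : ℕ × ℕ → Finset ℕ) (P : ℕ × ℕ → Prop)
    (k : ℕ) : ℕ := by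
  classical exact (cells.filter fun c => P c ∧ k ∈ F c).card

/-- The number of occurrences of `k` in `v` and in the boxes read before `c`. -/
noncomputable def countBefore (cells : Finset (ℕ × ℕ)) (v : List ℕ) (F : ℕ × ℕ → Finset ℕ)
    (k : ℕ) (c : ℕ × ℕ) : ℕ :=
  v.count k + boxCount cells F (fun g => readingPos g < readingPos c) k

section Counting

variable {cells : Finset (ℕ × ℕ)} {v : List ℕ} {F G : ℕ × ℕ → Finset ℕ} {k : ℕ}

lemma boxCount_congr {P : ℕ × ℕ → Prop} (h : ∀ g ∈ cells, (k ∈ F g ↔ k ∈ G g)) :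
    boxCount cells F P k = boxCount cells G P k := by
  classical
  unfold boxCount
  congr 1
  apply Finset.filter_congr
  intro g hg
  rw [h g hg]

lemma boxCount_eq_add_one {P : ℕ × ℕ → Prop} {b : ℕ × ℕ} (hb : b ∈ cells)
    (h : ∀ g, g ≠ b → (k ∈ F g ↔ k ∈ G g)) (hF : k ∈ F b) (hG : k ∉ G b) (hP : P b) :
    boxCount cells F P k = boxCount cells G P k + 1 := by
  classical
  unfold boxCount
  rw [← Finset.card_insert_of_notMem (a := b) (by simp [hG])]
  congr 1
  ext g
  by_cases hg : g = b
  · subst hg; simp [hb, hF, hP]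
  · simp [hg, h g hg]

lemma boxCount_eq_of_not {P : ℕ × ℕ → Prop} {b : ℕ × ℕ}
    (h : ∀ g, g ≠ b → (k ∈ F g ↔ k ∈ G g)) (hP : ¬ P b) :
    boxCount cells F P k = boxCount cells G P k := by
  classical
  unfold boxCount
  congr 1
  apply Finset.filter_congr
  intro g _
  by_cases hg : g = b
  · subst hg; simp [hP]
  · simp [h g hg]

lemma countBefore_congr {c : ℕ × ℕ} (h : ∀ g ∈ cells, (k ∈ F g ↔ k ∈ G g)) :
    countBefore cells v F k c = countBefore cells v G k c := by
  unfold countBefore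
  rw [boxCount_congr h]

lemma countBefore_eq_add_one {b c : ℕ × ℕ} (hb : b ∈ cells)
    (h : ∀ g, g ≠ b → (k ∈ F g ↔ k ∈ G g)) (hF : k ∈ F b) (hG : k ∉ G b)
    (hbc : readingPos b < readingPos c) :
    countBefore cells v F k c = countBefore cells v G k c + 1 := by
  unfold countBefore
  rw [boxCount_eq_add_one hb h hF hG hbc, add_assoc]

lemma countBefore_eq_of_not_lt {b c : ℕ × ℕ} (h : ∀ g, g ≠ b → (k ∈ F g ↔ k ∈ G g))
    (hbc : ¬ readingPos b < readingPos c) :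
    countBefore cells v F k c = countBefore cells v G k c := by
  unfold countBefore
  rw [boxCount_eq_of_not h hbc]

lemma countBefore_mono {c d : ℕ × ℕ} (h : readingPos c ≤ readingPos d) :
    countBefore cells v F k c ≤ countBefore cells v F k d := by
  classical
  unfold countBefore boxCount
  gcongr

lemma countBefore_lt {c d : ℕ × ℕ} (hc : c ∈ cells) (hk : k ∈ F c)
    (h : readingPos c < readingPos d) :
    countBefore cells v F k c < countBefore cells v F k d := by
  classical
  unfold countBefore boxCount
  gcongr
  rw [Finset.ssubset_iff]
  refine ⟨c, by simp, ?_⟩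
  intro g hg
  simp only [Finset.mem_insert, Finset.mem_filter] at hg ⊢
  rcases hg with rfl | ⟨h1, h2, h3⟩
  · exact ⟨hc, h, hk⟩
  · exact ⟨h1, h2.trans h, h3⟩

lemma countBefore_le_add_one {c d : ℕ × ℕ}
    (h : ∀ g ∈ cells, k ∈ F g → readingPos c < readingPos g →
      ¬ readingPos g < readingPos d) :
    countBefore cells v F k d ≤ countBefore cells v F k c + 1 := by
  classical
  unfold countBefore boxCount
  rw [add_assoc]
  gcongr v.count k + ?_
  refine le_trans (Finset.card_le_card (t := insert c _) ?_) (Finset.card_insert_le _ _)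
  intro g hg
  simp only [Finset.mem_insert, Finset.mem_filter] at hg ⊢
  obtain ⟨h1, h2, h3⟩ := hg
  rcases lt_trichotomy (readingPos g) (readingPos c) with h4 | h4 | h4
  · exact Or.inr ⟨h1, h4, h3⟩
  · exact Or.inl (readingPos_injective h4)
  · exact absurd h2 (h g h1 h3 h4)

lemma countBefore_le {c d : ℕ × ℕ}
    (h : ∀ g ∈ cells, k ∈ F g → readingPos c ≤ readingPos g →
      ¬ readingPos g < readingPos d) :
    countBefore cells v F k d ≤ countBefore cells v F k c := by
  classical
  unfold countBefore boxCount
  gcongr v.count k + ?_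
  apply Finset.card_le_card
  intro g hg
  simp only [Finset.mem_filter] at hg ⊢
  obtain ⟨h1, h2, h3⟩ := hg
  refine ⟨h1, ?_, h3⟩
  by_contra h4
  exact h g h1 h3 (not_lt.mp h4) h2

/-- If the lattice condition holds box by box before `d`, then it holds when `d` is reached. -/
lemma countBefore_succ_le {d : ℕ × ℕ} (hv : v.count (k + 1) ≤ v.count k)
    (h : ∀ g ∈ cells, readingPos g < readingPos d → k + 1 ∈ F g →
      countBefore cells v F (k + 1) g < countBefore cells v F k g ∨
      k ∈ F g ∧ countBefore cells v F (k + 1) g ≤ countBefore cells v F k g) :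
    countBefore cells v F (k + 1) d ≤ countBefore cells v F k d := by
  classical
  by_cases hne : (cells.filter fun g => readingPos g < readingPos d ∧ k + 1 ∈ F g).Nonempty
  · obtain ⟨g, hg, hmax⟩ := Finset.exists_max_image _ readingPos hne
    simp only [Finset.mem_filter] at hg hmax
    obtain ⟨hgc, hgd, hgk⟩ := hg
    have h1 : countBefore cells v F (k + 1) d ≤ countBefore cells v F (k + 1) g + 1 :=
      countBefore_le_add_one fun e he hke hge hed =>
        absurd (hmax e ⟨he, hed, hke⟩) (not_le.mpr hge)
    rcases h g hgc hgd hgk with h2 | ⟨h2, h3⟩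
    · have := countBefore_mono (cells := cells) (v := v) (F := F) (k := k) hgd.le
      omega
    · have := countBefore_lt (v := v) hgc h2 hgd
      omega
  · rw [Finset.not_nonempty_iff_eq_empty] at hne
    unfold countBefore
    have : boxCount cells F (fun g => readingPos g < readingPos d) (k + 1) = 0 := by
      unfold boxCount
      rw [Finset.card_eq_zero]
      convert hne
    omega

end Counting

section Words

lemma isRLW_cons {a : ℕ} {w : List ℕ} :
    IsRLW (a :: w) ↔ IsRLW w ∧ ∀ k, (a :: w).count (k + 1) ≤ (a :: w).count k := by
  constructor
  · intro h
    exact ⟨fun s hs => h s (hs.trans (List.suffix_cons a w)), h _ List.suffix_rfl⟩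
  · rintro ⟨h1, h2⟩ s hs
    rcases List.suffix_cons_iff.mp hs with rfl | hs
    · exact h2
    · exact h1 s hs

lemma isRLW_append_of_pairwise_lt {A u : List ℕ} (hA : A.Pairwise (· < ·)) :
    IsRLW (A ++ u) ↔ IsRLW u ∧ ∀ k, k + 1 ∈ A → u.count (k + 1) < u.count k := by
  induction A with
  | nil => simp
  | cons a A ih =>
    rw [List.pairwise_cons] at hA
    obtain ⟨ha, hA⟩ := hA
    have key : ∀ k, k + 1 = a → A.count (k + 1) = 0 ∧ A.count k = 0 := by
      intro k hk
      constructor <;> rw [List.count_eq_zero] <;> intro hm <;> have := ha _ hm <;> omega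
    rw [List.cons_append, isRLW_cons, ih hA]
    constructor
    · rintro ⟨⟨h1, h2⟩, h3⟩
      refine ⟨h1, fun k hk => ?_⟩
      rcases List.mem_cons.mp hk with hk | hk
      · have h4 := h3 k
        obtain ⟨h5, h6⟩ := key k hk
        subst hk
        rw [List.count_cons_self, List.count_cons_of_ne (by omega), List.count_append,
          List.count_append, h5, h6] at h4
        omega
      · exact h2 k hk
    · rintro ⟨h1, h2⟩
      have h3 : IsRLW u ∧ ∀ k, k + 1 ∈ A → u.count (k + 1) < u.count k :=
        ⟨h1, fun k hk => h2 k (List.mem_cons_of_mem _ hk)⟩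
      refine ⟨h3, fun k => ?_⟩
      by_cases hk : k + 1 = a
      · obtain ⟨h5, h6⟩ := key k hk
        have h4 := h2 k (by simp [hk])
        subst hk
        rw [List.count_cons_self, List.count_cons_of_ne (by omega), List.count_append,
          List.count_append, h5, h6]
        omega
      · have h4 := (ih hA).mpr h3 _ List.suffix_rfl k
        rw [List.count_cons_of_ne (Ne.symm hk)]
        exact h4.trans List.count_le_count_cons

lemma count_flatMap_sort (F : ℕ × ℕ → Finset ℕ) (L : List (ℕ × ℕ)) (k : ℕ) :
    (L.flatMap fun c => (F c).sort (· ≤ ·)).count k = L.countP fun c => k ∈ F c := by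
  induction L with
  | nil => simp
  | cons c L ih =>
    rw [List.flatMap_cons, List.count_append, ih, List.countP_cons, add_comm]
    congr 1
    by_cases hk : k ∈ F c
    · simp only [hk, decide_true, if_true]
      exact List.count_eq_one_of_mem (Finset.sort_nodup _ _) ((Finset.mem_sort _).mpr hk)
    · simp only [hk, decide_false]
      exact List.count_eq_zero_of_not_mem fun h => hk ((Finset.mem_sort _).mp h)

lemma isRLW_flatMap_sort (F : ℕ × ℕ → Finset ℕ) (v : List ℕ) (L : List (ℕ × ℕ))
    (hL : L.Pairwise fun c d => readingPos d < readingPos c) :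
    IsRLW ((L.flatMap fun c => (F c).sort (· ≤ ·)) ++ v) ↔
      IsRLW v ∧ ∀ c ∈ L, ∀ k, k + 1 ∈ F c →
        v.count (k + 1) + L.countP (fun g => readingPos g < readingPos c ∧ k + 1 ∈ F g) <
        v.count k + L.countP (fun g => readingPos g < readingPos c ∧ k ∈ F g) := by
  induction L with
  | nil => simp
  | cons c L ih =>
    rw [List.pairwise_cons] at hL
    obtain ⟨hc, hL⟩ := hL
    rw [List.flatMap_cons, List.append_assoc,
      isRLW_append_of_pairwise_lt (Finset.sortedLT_sort _).pairwise, ih hL, and_assoc]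
    refine and_congr_right fun _ => ?_
    rw [List.forall_mem_cons, and_comm]
    refine and_congr ?_ ?_
    · refine forall_congr' fun k => ?_
      rw [Finset.mem_sort]
      refine imp_congr_right fun _ => ?_
      have h1 : ∀ k, (c :: L).countP (fun g => readingPos g < readingPos c ∧ k ∈ F g) =
          L.countP fun g => k ∈ F g := by
        intro k
        rw [List.countP_cons_of_neg (by simp)]
        apply List.countP_congr
        intro g hg
        simp [hc g hg]
      rw [h1, h1, List.count_append, List.count_append, count_flatMap_sort, count_flatMap_sort,
        add_comm, add_comm (List.countP _ _)]
    · refine forall₂_congr fun g hg => forall_congr' fun k => imp_congr_right fun _ => ?_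
      have h1 : ∀ k, (c :: L).countP (fun e => readingPos e < readingPos g ∧ k ∈ F e) =
          L.countP fun e => readingPos e < readingPos g ∧ k ∈ F e := by
        intro k
        rw [List.countP_cons_of_neg]
        simp [(hc g hg).le]
      rw [h1, h1]

/-- The boxes of an `R × R` square, in the order in which the column word reads them. -/
def squareBoxes (R : ℕ) : List (ℕ × ℕ) :=
  (List.range R).flatMap fun j => (List.range R).reverse.map fun i => (i, j)

lemma mem_squareBoxes {R : ℕ} {c : ℕ × ℕ} : c ∈ squareBoxes R ↔ c.1 < R ∧ c.2 < R := by
  obtain ⟨i, j⟩ := c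
  simp [squareBoxes, and_comm]

lemma pairwise_squareBoxes (R : ℕ) :
    (squareBoxes R).Pairwise fun c d => readingPos d < readingPos c := by
  unfold squareBoxes
  rw [List.pairwise_flatMap]
  constructor
  · intro j _
    rw [List.pairwise_map, List.pairwise_reverse]
    refine List.pairwise_lt_range.imp fun h => ?_
    rw [readingPos_lt]
    omega
  · refine List.pairwise_lt_range.imp fun {j j'} h => ?_
    intro c hc d hd
    simp only [List.mem_map] at hc hd
    obtain ⟨i, -, rfl⟩ := hc
    obtain ⟨i', -, rfl⟩ := hd
    rw [readingPos_lt]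
    omega

variable {cells : Finset (ℕ × ℕ)}

/-- All boxes of `cells` lie in a square of this size. -/
def boxBound (cells : Finset (ℕ × ℕ)) : ℕ := (cells.sup fun c => max c.1 c.2) + 1

lemma mem_squareBoxes_of_mem {c : ℕ × ℕ} (hc : c ∈ cells) : c ∈ squareBoxes (boxBound cells) := by
  have : max c.1 c.2 ≤ _ := Finset.le_sup (f := fun c : ℕ × ℕ => max c.1 c.2) hc
  rw [mem_squareBoxes, boxBound]
  omega

lemma SVT.word_eq (T : SVT cells) :
    T.word = (squareBoxes (boxBound cells)).flatMap fun c => (T.entry c).sort (· ≤ ·) := by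
  simp only [SVT.word, squareBoxes, boxBound, List.flatMap_assoc, List.flatMap_map]

lemma SVT.mem_cells (T : SVT cells) {c : ℕ × ℕ} {k : ℕ} (h : k ∈ T.entry c) : c ∈ cells := by
  by_contra hc
  simp [T.eq_empty_of_not_mem c hc] at h

lemma SVT.countP_eq_boxCount (T : SVT cells) (P : ℕ × ℕ → Prop) [DecidablePred P] (k : ℕ) :
    (squareBoxes (boxBound cells)).countP (fun c => P c ∧ k ∈ T.entry c) =
      boxCount cells T.entry P k := by
  classical
  have hnd : (squareBoxes (boxBound cells)).Nodup :=
    (pairwise_squareBoxes _).imp fun h h' => by subst h'; exact lt_irrefl _ h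
  unfold boxCount
  rw [List.countP_eq_length_filter, ← List.toFinset_card_of_nodup (hnd.filter _)]
  congr 1
  ext c
  simp only [List.mem_toFinset, List.mem_filter, decide_eq_true_eq, Finset.mem_filter]
  exact ⟨fun h => ⟨T.mem_cells h.2.2, h.2⟩, fun h => ⟨mem_squareBoxes_of_mem h.1, h.2⟩⟩

lemma SVT.count_word (T : SVT cells) (k : ℕ) :
    T.word.count k = boxCount cells T.entry (fun _ => True) k := by
  rw [T.word_eq, count_flatMap_sort, ← T.countP_eq_boxCount]
  simp

lemma SVT.isRLW_word_append (T : SVT cells) (v : List ℕ) :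
    IsRLW (T.word ++ v) ↔ IsRLW v ∧ ∀ c k, k + 1 ∈ T.entry c →
      countBefore cells v T.entry (k + 1) c < countBefore cells v T.entry k c := by
  classical
  rw [T.word_eq, isRLW_flatMap_sort _ _ _ (pairwise_squareBoxes _)]
  refine and_congr_right fun _ => ?_
  simp only [T.countP_eq_boxCount (fun g => readingPos g < readingPos _), countBefore]
  exact ⟨fun h c k hk => h c (mem_squareBoxes_of_mem (T.mem_cells hk)) k hk,
    fun h c _ k hk => h c k hk⟩

end Words

namespace SVT

variable {cells : Finset (ℕ × ℕ)}

lemma col_strict_of_lt (hconv : ∀ p q r : ℕ × ℕ, p ∈ cells → r ∈ cells → p ≤ q → q ≤ r → q ∈ cells)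
    (T : SVT cells) {i i' j a b : ℕ} (hii : i < i') (ha : a ∈ T.entry (i, j))
    (hb : b ∈ T.entry (i', j)) : a < b := by
  induction i', hii using Nat.le_induction generalizing b with
  | base => exact T.col_strict i j (T.mem_cells ha) (T.mem_cells hb) a ha b hb
  | succ m hm ih =>
    have hmem : (m, j) ∈ cells :=
      hconv (i, j) _ (m + 1, j) (T.mem_cells ha) (T.mem_cells hb)
        ⟨by simp only; omega, le_rfl⟩ ⟨by simp only; omega, le_rfl⟩
    obtain ⟨z, hz⟩ := T.nonempty_of_mem _ hmem
    exact (ih hz).trans (T.col_strict m j hmem (T.mem_cells hb) z hz b hb)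

/-- Remove the entry `y` from a shared box `b`. -/
def eraseEntry (T : SVT cells) (b : ℕ × ℕ) (y : ℕ) (hb : 2 ≤ (T.entry b).card) : SVT cells where
  entry := Function.update T.entry b ((T.entry b).erase y)
  nonempty_of_mem c hc := by
    by_cases h : c = b
    · subst h
      rw [Function.update_self, ← Finset.card_pos]
      have := Finset.pred_card_le_card_erase (s := T.entry c) (a := y)
      omega
    · rw [Function.update_of_ne h]
      exact T.nonempty_of_mem c hc
  eq_empty_of_not_mem c hc := by
    by_cases h : c = b
    · subst h
      simp [T.eq_empty_of_not_mem c hc]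
    · rw [Function.update_of_ne h]
      exact T.eq_empty_of_not_mem c hc
  row_weak i j h1 h2 x hx z hz := by
    apply T.row_weak i j h1 h2
    · rw [Function.update_apply] at hx
      split_ifs at hx with h
      · rw [h]; exact Finset.mem_of_mem_erase hx
      · exact hx
    · rw [Function.update_apply] at hz
      split_ifs at hz with h
      · rw [h]; exact Finset.mem_of_mem_erase hz
      · exact hz
  col_strict i j h1 h2 x hx z hz := by
    apply T.col_strict i j h1 h2
    · rw [Function.update_apply] at hx
      split_ifs at hx with h
      · rw [h]; exact Finset.mem_of_mem_erase hx
      · exact hx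
    · rw [Function.update_apply] at hz
      split_ifs at hz with h
      · rw [h]; exact Finset.mem_of_mem_erase hz
      · exact hz

lemma mem_eraseEntry {T : SVT cells} {b c : ℕ × ℕ} {y k : ℕ} {hb : 2 ≤ (T.entry b).card} :
    k ∈ (T.eraseEntry b y hb).entry c ↔ k ∈ T.entry c ∧ ¬ (c = b ∧ k = y) := by
  simp only [eraseEntry, Function.update_apply]
  split_ifs with h
  · subst h; simp [and_comm]
  · simp [h]

/-- Replace the set of a box `c` containing only `y + 1` by `{y, y + 1}`. -/
def insertEntry (T : SVT cells) (c : ℕ × ℕ) (y : ℕ) (hc : T.entry c = {y + 1})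
    (hleft : ∀ i j, c = (i, j + 1) → y + 1 ∉ T.entry (i, j))
    (habove : ∀ i j, c = (i + 1, j) → y ∉ T.entry (i, j)) : SVT cells where
  entry := Function.update T.entry c {y, y + 1}
  nonempty_of_mem g hg := by
    by_cases h : g = c
    · subst h; simp
    · rw [Function.update_of_ne h]
      exact T.nonempty_of_mem g hg
  eq_empty_of_not_mem g hg := by
    have h : g ≠ c := by
      rintro rfl
      exact hg (T.mem_cells (k := y + 1) (by simp [hc]))
    rw [Function.update_of_ne h]
    exact T.eq_empty_of_not_mem g hg
  row_weak i j h1 h2 x hx z hz := by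
    have key := T.row_weak i j h1 h2
    rw [Function.update_apply] at hx hz
    split_ifs at hx hz with h3 h4 h4
    · simp [← h4] at h3
    · simp only [Finset.mem_insert, Finset.mem_singleton] at hx
      have := key (y + 1) (by simp [h3, hc]) z hz
      omega
    · simp only [Finset.mem_insert, Finset.mem_singleton] at hz
      have h5 := key x hx (y + 1) (by simp [h4, hc])
      have h6 : x ≠ y + 1 := by
        rintro rfl
        exact hleft i j h4.symm hx
      omega
    · exact key x hx z hz
  col_strict i j h1 h2 x hx z hz := by
    have key := T.col_strict i j h1 h2
    rw [Function.update_apply] at hx hz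
    split_ifs at hx hz with h3 h4 h4
    · simp [← h4] at h3
    · simp only [Finset.mem_insert, Finset.mem_singleton] at hx
      have := key (y + 1) (by simp [h3, hc]) z hz
      omega
    · simp only [Finset.mem_insert, Finset.mem_singleton] at hz
      have h5 := key x hx (y + 1) (by simp [h4, hc])
      have h6 : x ≠ y := by
        rintro rfl
        exact habove i j h4.symm hx
      omega
    · exact key x hx z hz

lemma mem_insertEntry {T : SVT cells} {c g : ℕ × ℕ} {y k : ℕ} {hc : T.entry c = {y + 1}}
    {hleft habove} :
    k ∈ (T.insertEntry c y hc hleft habove).entry g ↔ k ∈ T.entry g ∨ g = c ∧ k = y := by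
  simp only [insertEntry, Function.update_apply]
  split_ifs with h
  · subst h; simp [hc, or_comm]
  · simp [h]

lemma exists_remove_entry
    (hconv : ∀ p q r : ℕ × ℕ, p ∈ cells → r ∈ cells → p ≤ q → q ≤ r → q ∈ cells)
    (v : List ℕ) (hv : IsRLW v) (n : ℕ) (T : SVT cells) (b : ℕ × ℕ) (y : ℕ)
    (hb : 2 ≤ (T.entry b).card) (hyb : y ∈ T.entry b)
    (hymax : ∀ c, 2 ≤ (T.entry c).card → ∀ z ∈ T.entry c, z ≤ y)
    (hbound : ∀ c, ∀ z ∈ T.entry c, z < y + n)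
    (hlat : ∀ c k, k + 1 ∈ T.entry c →
      countBefore cells v T.entry (k + 1) c < countBefore cells v T.entry k c ∨
      (c = b ∧ k + 1 = y) ∧ k ∈ T.entry c ∧
        countBefore cells v T.entry (k + 1) c ≤ countBefore cells v T.entry k c) :
    ∃ x, y ≤ x ∧ ∃ Tt : SVT cells,
      IsRLW (Tt.word ++ v) ∧ ∀ i, (x :: Tt.word).count i = T.word.count i := by
  classical
  induction n generalizing T b y with
  | zero => exact absurd (hbound b y hyb) (by omega)
  | succ n ih =>
    have hbc : b ∈ cells := T.mem_cells hyb
    set S := T.eraseEntry b y hb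
    have hSmem : ∀ {c k}, k ∈ S.entry c ↔ k ∈ T.entry c ∧ ¬ (c = b ∧ k = y) := mem_eraseEntry
    have hSy : ∀ g, g ≠ b → (y ∈ T.entry g ↔ y ∈ S.entry g) := fun g hg => by simp [hSmem, hg]
    have hSb : y ∉ S.entry b := by simp [hSmem]
    have hSk : ∀ k, k ≠ y → ∀ g, (k ∈ T.entry g ↔ k ∈ S.entry g) :=
      fun k hk g => by simp [hSmem, hk]
    have hNk : ∀ k, k ≠ y → ∀ g,
        countBefore cells v T.entry k g = countBefore cells v S.entry k g :=
      fun k hk g => countBefore_congr fun e _ => hSk k hk e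
    have hNy : ∀ g, countBefore cells v S.entry y g ≤ countBefore cells v T.entry y g := by
      intro g
      by_cases hg : readingPos b < readingPos g
      · rw [countBefore_eq_add_one hbc hSy hyb hSb hg]; omega
      · exact (countBefore_eq_of_not_lt hSy hg).ge
    by_cases hviol : (cells.filter fun c => y + 1 ∈ T.entry c ∧
        countBefore cells v S.entry y c ≤ countBefore cells v S.entry (y + 1) c).Nonempty
    swap
    · refine ⟨y, le_rfl, S, ?_, ?_⟩
      · rw [S.isRLW_word_append]
        refine ⟨hv, fun c k hk => ?_⟩
        obtain ⟨hkT, hkb⟩ := hSmem.mp hk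
        by_cases hky : k = y
        · subst hky
          by_contra hcon
          exact hviol ⟨c, by simp [T.mem_cells hkT, hkT, not_lt.mp hcon]⟩
        · rcases hlat c k hkT with h1 | h1
          · rw [← hNk k hky]
            by_cases hky' : k + 1 = y
            · have := hNy c
              rw [← hky'] at this
              omega
            · rwa [← hNk _ hky']
          · exact absurd h1.1 hkb
      · intro i
        rw [List.count_cons, T.count_word, S.count_word]
        by_cases hi : i = y
        · subst hi
          rw [boxCount_eq_add_one hbc hSy hyb hSb trivial]
          simp
        · rw [boxCount_congr fun g _ => hSk i hi g]
          simp [Ne.symm hi]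
    obtain ⟨c, hc, hcmin⟩ := Finset.exists_min_image _ readingPos hviol
    simp only [Finset.mem_filter] at hc hcmin
    obtain ⟨hcc, hyc, hcviol⟩ := hc
    have hTc : T.entry c = {y + 1} := by
      have h1 : (T.entry c).card ≤ 1 := by
        by_contra hcon
        have := hymax c (by omega) (y + 1) hyc
        omega
      exact Finset.eq_singleton_iff_unique_mem.mpr
        ⟨hyc, fun z hz => Finset.card_le_one.mp h1 z hz (y + 1) hyc⟩
    have hlaty : ∀ g, y + 1 ∈ T.entry g →
        countBefore cells v T.entry (y + 1) g < countBefore cells v T.entry y g := by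
      intro g hg
      rcases hlat g y hg with h1 | ⟨⟨-, h1⟩, -⟩
      · exact h1
      · omega
    have hcT := hlaty c hyc
    rw [hNk (y + 1) (by omega)] at hcT
    have hbltc : readingPos b < readingPos c := by
      by_contra hcon
      rw [countBefore_eq_of_not_lt hSy hcon] at hcT
      omega
    have hNyc := countBefore_eq_add_one (v := v) hbc hSy hyb hSb hbltc
    have hNc : countBefore cells v S.entry y c = countBefore cells v T.entry (y + 1) c := by
      rw [hNk (y + 1) (by omega)]
      omega
    have hbefore : ∀ g, readingPos g < readingPos c → y + 1 ∈ T.entry g →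
        countBefore cells v S.entry (y + 1) g < countBefore cells v S.entry y g := by
      intro g hg hyg
      by_contra hcon
      exact absurd (hcmin g ⟨T.mem_cells hyg, hyg, not_lt.mp hcon⟩) (not_le.mpr hg)
    have hbefore' : ∀ g, readingPos g ≤ readingPos c →
        countBefore cells v S.entry (y + 1) g ≤ countBefore cells v S.entry y g := by
      intro g hg
      refine countBefore_succ_le (hv v List.suffix_rfl y) fun e _ heg hye => Or.inl ?_
      exact hbefore e (heg.trans_le hg) (hSmem.mp hye).1
    have habove : ∀ i j, c = (i + 1, j) → y ∉ S.entry (i, j) := by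
      rintro i j rfl hy
      obtain ⟨hyT, hne⟩ := hSmem.mp hy
      have hlt : readingPos (i, j) < readingPos (i + 1, j) := readingPos_lt.mpr (by omega)
      have h1 := hbefore' (i, j) hlt.le
      have h2 := countBefore_lt (v := v) (S.mem_cells hy) hy hlt
      have h3 : countBefore cells v S.entry (y + 1) (i + 1, j) ≤
          countBefore cells v S.entry (y + 1) (i, j) := by
        refine countBefore_le ?_
        rintro ⟨i', j'⟩ _ hg h4 h5
        obtain ⟨rfl, rfl⟩ : i' = i ∧ j' = j := by
          rw [← not_lt, readingPos_lt] at h4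
          rw [readingPos_lt] at h5
          omega
        have := S.col_strict i' j' (S.mem_cells hg) hcc (y + 1) hg (y + 1)
          (hSmem.mpr ⟨hyc, by omega⟩)
        omega
      omega
    have hleft : ∀ i j, c = (i, j + 1) → y + 1 ∉ S.entry (i, j) := by
      rintro i j rfl hd
      have hdT := (hSmem.mp hd).1
      have hlt : readingPos (i, j + 1) < readingPos (i, j) := readingPos_lt.mpr (by omega)
      have h1 := hlaty (i, j) hdT
      have h2 := countBefore_lt (v := v) hcc hyc hlt
      have h3 : ¬ countBefore cells v T.entry y (i, j) ≤
          countBefore cells v T.entry y (i, j + 1) := by omega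
      apply h3
      refine countBefore_le ?_
      rintro ⟨i', j'⟩ he hye h4 h5
      rw [← not_lt, readingPos_lt] at h4
      rw [readingPos_lt] at h5
      rcases (by omega : (j' = j + 1 ∧ i ≤ i') ∨ (j' = j ∧ i' < i)) with ⟨rfl, h6⟩ | ⟨rfl, h6⟩
      · rcases h6.eq_or_lt with rfl | h6
        · simp [hTc] at hye
        · have := T.col_strict_of_lt hconv h6 hyc hye
          omega
      · obtain ⟨m, rfl⟩ : ∃ m, i = m + 1 := ⟨i - 1, by omega⟩
        have hm : i' = m := by
          by_contra hcon
          obtain ⟨z, hz⟩ := T.nonempty_of_mem (m, j') <|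
            hconv (i', j') _ (m + 1, j') he (T.mem_cells hdT)
              ⟨by simp only; omega, le_rfl⟩ ⟨by simp only; omega, le_rfl⟩
          have h7 := T.col_strict_of_lt hconv (by omega) hye hz
          have h8 := T.col_strict_of_lt hconv (by omega) hz hdT
          omega
        subst hm
        have hac : (i', j' + 1) ∈ cells :=
          hconv (i', j') _ (i' + 1, j' + 1) he hcc
            ⟨le_rfl, by simp only; omega⟩ ⟨by simp only; omega, le_rfl⟩
        have hall : ∀ z ∈ T.entry (i', j' + 1), z = y := by
          intro z hz
          have h7 := T.row_weak i' j' he hac y hye z hz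
          have h8 := T.col_strict i' (j' + 1) hac hcc z hz (y + 1) hyc
          omega
        obtain ⟨z, hz⟩ := T.nonempty_of_mem _ hac
        obtain rfl := hall z hz
        refine habove i' (j' + 1) rfl (hSmem.mpr ⟨hz, ?_⟩)
        rintro ⟨rfl, -⟩
        have : (T.entry (i', j' + 1)).card ≤ 1 :=
          Finset.card_le_one.mpr fun p hp q hq => (hall p hp).trans (hall q hq).symm
        omega
    have hcb : c ≠ b := by
      rintro rfl
      exact lt_irrefl _ hbltc
    have hSc : S.entry c = {y + 1} := by
      ext k
      simp [hSmem, hTc, hcb]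
    set U := S.insertEntry c y hSc hleft habove
    have hUmem : ∀ {g k}, k ∈ U.entry g ↔ k ∈ S.entry g ∨ g = c ∧ k = y := mem_insertEntry
    have hUy : ∀ g, g ≠ c → (y ∈ U.entry g ↔ y ∈ S.entry g) := fun g hg => by simp [hUmem, hg]
    have hUc : y ∈ U.entry c := by simp [hUmem]
    have hScy : y ∉ S.entry c := by simp [hSc]
    have hUk : ∀ k, k ≠ y → ∀ g, (k ∈ T.entry g ↔ k ∈ U.entry g) :=
      fun k hk g => by simp [hUmem, hSmem, hk]
    have hMk : ∀ k, k ≠ y → ∀ g,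
        countBefore cells v U.entry k g = countBefore cells v T.entry k g :=
      fun k hk g => (countBefore_congr fun e _ => hUk k hk e).symm
    have hMlt : ∀ g, ¬ readingPos c < readingPos g →
        countBefore cells v U.entry y g = countBefore cells v S.entry y g :=
      fun g hg => countBefore_eq_of_not_lt hUy hg
    have hMgt : ∀ g, readingPos c < readingPos g →
        countBefore cells v U.entry y g = countBefore cells v T.entry y g := by
      intro g hg
      rw [countBefore_eq_add_one hcc hUy hUc hScy hg,
        countBefore_eq_add_one hbc hSy hyb hSb (hbltc.trans hg)]
    have hUsub : ∀ g, g ≠ c → U.entry g ⊆ T.entry g := by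
      intro g hg k hk
      rcases hUmem.mp hk with h1 | ⟨h1, -⟩
      · exact (hSmem.mp h1).1
      · exact absurd h1 hg
    have hUcle : ∀ z ∈ U.entry c, z ≤ y + 1 := by
      intro z hz
      rcases hUmem.mp hz with h1 | ⟨-, h1⟩
      · simp [hSc] at h1; omega
      · omega
    have hyc' : y + 1 ∈ U.entry c := (hUk _ (by omega) _).mp hyc
    obtain ⟨x, hx, Tt, hTt, hcont⟩ := ih U c (y + 1)
      (Finset.one_lt_card.mpr ⟨y, hUc, y + 1, hyc', by omega⟩)
      hyc'
      (by
        intro g hg z hz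
        by_cases hgc : g = c
        · subst hgc; exact hUcle z hz
        · exact (hymax g (hg.trans (Finset.card_le_card (hUsub g hgc))) z
            (hUsub g hgc hz)).trans (by omega))
      (by
        intro g z hz
        by_cases hgc : g = c
        · subst hgc
          have := hUcle z hz
          have := hbound g (y + 1) hyc
          omega
        · have := hbound g z (hUsub g hgc hz)
          omega)
      (by
        intro g k hk
        by_cases hky : k = y
        · subst hky
          have hkT := (hUk _ (by omega) g).mpr hk
          rw [hMk _ (by omega)]
          rcases lt_trichotomy (readingPos g) (readingPos c) with h1 | h1 | h1
          · left
            rw [hMlt g h1.not_gt, hNk _ (by omega)]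
            exact hbefore g h1 hkT
          · obtain rfl := readingPos_injective h1
            right
            refine ⟨⟨rfl, rfl⟩, hUc, ?_⟩
            rw [hMlt g (lt_irrefl _), hNc]
          · left
            rw [hMgt g h1]
            exact hlaty g hkT
        · left
          rw [hMk k hky]
          by_cases hky' : k + 1 = y
          · by_cases hgc : g = c
            · subst hgc
              have h1 : countBefore cells v T.entry (k + 1) g ≤ countBefore cells v T.entry k g :=
                countBefore_succ_le (hv v List.suffix_rfl k) fun e _ _ hke =>
                  (hlat e k hke).imp_right And.right
              rw [hky'] at h1 ⊢
              rw [hMlt g (lt_irrefl _)]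
              omega
            · have hkS : k + 1 ∈ S.entry g := by
                rcases hUmem.mp hk with h1 | ⟨h1, -⟩
                · exact h1
                · exact absurd h1 hgc
              obtain ⟨hkT, hkb⟩ := hSmem.mp hkS
              have h1 : countBefore cells v T.entry (k + 1) g < countBefore cells v T.entry k g :=
                (hlat g k hkT).resolve_right fun h2 => hkb h2.1
              refine lt_of_le_of_lt ?_ h1
              rw [hky']
              by_cases h2 : readingPos c < readingPos g
              · rw [hMgt g h2]
              · rw [hMlt g h2]
                exact hNy g
          · rw [hMk _ hky']
            exact (hlat g k ((hUk _ hky' g).mpr hk)).resolve_right fun h2 => hky' h2.1.2)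
    refine ⟨x, by omega, Tt, hTt, fun i => (hcont i).trans ?_⟩
    rw [U.count_word, T.count_word]
    by_cases hi : i = y
    · subst hi
      rw [boxCount_eq_add_one hcc hUy hUc hScy trivial,
        boxCount_eq_add_one hbc hSy hyb hSb trivial]
    · exact (boxCount_congr fun g _ => hUk i hi g).symm

end SVT

/-- **Removing a large entry from a shared box** (Lemma 7.3): let `T` be a
set-valued tableau of shape `ν/λ` with at least one shared box, `y` the
largest integer in a shared box of `T`, and `v` a sequence such that
`w(T) ∘ v` is a reverse lattice word.  Then there are `x ≥ y` and a tableau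
`T̃` of shape `ν/λ` with `w(T̃) ∘ v` a reverse lattice word and the content of
`(x) ∘ w(T̃)` equal to that of `w(T)`. -/
theorem remove_large_shared_entry (lam nu : YoungDiagram) (h : lam ≤ nu)
    (T : SVT (nu.cells \ lam.cells)) (y : ℕ)
    (hy : ∃ c ∈ nu.cells \ lam.cells, 2 ≤ (T.entry c).card ∧ y ∈ T.entry c)
    (hymax : ∀ c ∈ nu.cells \ lam.cells, 2 ≤ (T.entry c).card →
      ∀ z ∈ T.entry c, z ≤ y)
    (v : List ℕ) (hv : IsRLW (T.word ++ v)) :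
    ∃ x, y ≤ x ∧ ∃ Tt : SVT (nu.cells \ lam.cells),
      IsRLW (Tt.word ++ v) ∧ ∀ i, (x :: Tt.word).count i = T.word.count i := by
  obtain ⟨b, -, hb, hyb⟩ := hy
  have hconv : ∀ p q r : ℕ × ℕ, p ∈ nu.cells \ lam.cells → r ∈ nu.cells \ lam.cells →
      p ≤ q → q ≤ r → q ∈ nu.cells \ lam.cells := by
    intro p q r hp hr hpq hqr
    rw [Finset.mem_sdiff] at hp hr ⊢
    exact ⟨nu.isLowerSet hqr hr.1, fun hq => hp.2 (lam.isLowerSet hpq hq)⟩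
  obtain ⟨hv', hlat⟩ := (T.isRLW_word_append v).mp hv
  refine SVT.exists_remove_entry hconv v hv'
    (((nu.cells \ lam.cells).sup fun c => (T.entry c).sup id) + 1) T b y hb hyb ?_ ?_
    fun c k hk => Or.inl (hlat c k hk)
  · exact fun c hc z hz => hymax c (T.mem_cells hz) hc z hz
  · intro c z hz
    have h1 : z ≤ (T.entry c).sup id := Finset.le_sup (f := id) hz
    have h2 := Finset.le_sup (f := fun c => (T.entry c).sup id) (T.mem_cells hz)
    omega
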